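/- Let m̃ = (a₁, a₂, d, b, c) be a blow-up monad configuration, and set W = W₁ and m = π_#(m̃) = (d∘a₁, d∘a₂, d∘b, c), which is an ADHM configuration on W. Fix (x₁, x₂, x₃) ∈ ℂ³ with (x₁, x₂) ≠ (0,0), and set y₁ = x₂, y₂ = −x₁. Let p : W₀ ⊕ W₁ ⊕ W₀ ⊕ W₁ ⊕ ℂʳ → W₁ ⊕ W₁ ⊕ ℂʳ be the projection (v₀¹, v₁¹, v₀², v₁², u) ↦ (v₁¹, v₁², u). Then: (i) p maps ker B_{m̃}(x₁,x₂,x₃,y₁,y₂) into ker B_m(x₁,x₂,x₃); (ii) p ∘ A_{m̃}(x₁,x₂,x₃,y₁,y₂)(ξ₁, ξ₀) = A_m(x₁,x₂,x₃)(ξ₁) for all (ξ₁,ξ₀) ∈ W₁ ⊕ W₀; (iii) the induced linear map on quotients ker B_{m̃}/range A_{m̃} → ker B_m/range A_m is an isomorphism. -/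

import Mathlib

/-- The monad map `A_m(x₁,x₂,x₃) : W → W ⊕ W ⊕ ℂʳ` of an ADHM configuration. -/
noncomputable def adhmA {W : Type*} [AddCommGroup W] [Module ℂ W] {r : ℕ}
    (a₁ a₂ : W →ₗ[ℂ] W) (c : W →ₗ[ℂ] (Fin r → ℂ)) (x₁ x₂ x₃ : ℂ) :
    W →ₗ[ℂ] W × W × (Fin r → ℂ) :=
  LinearMap.prod (x₁ • LinearMap.id - x₃ • a₁)
    (LinearMap.prod (x₂ • LinearMap.id - x₃ • a₂) (x₃ • c))

/-- The monad map `B_m(x₁,x₂,x₃) : W ⊕ W ⊕ ℂʳ → W` of an ADHM configuration. -/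
noncomputable def adhmB {W : Type*} [AddCommGroup W] [Module ℂ W] {r : ℕ}
    (a₁ a₂ : W →ₗ[ℂ] W) (b : (Fin r → ℂ) →ₗ[ℂ] W) (x₁ x₂ x₃ : ℂ) :
    (W × W × (Fin r → ℂ)) →ₗ[ℂ] W :=
  (x₃ • a₂ - x₂ • LinearMap.id).comp (LinearMap.fst ℂ W (W × (Fin r → ℂ)))
    + (x₁ • LinearMap.id - x₃ • a₁).comp
        ((LinearMap.fst ℂ W (Fin r → ℂ)).comp (LinearMap.snd ℂ W (W × (Fin r → ℂ))))
    + (x₃ • b).comp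
        ((LinearMap.snd ℂ W (Fin r → ℂ)).comp (LinearMap.snd ℂ W (W × (Fin r → ℂ))))

/-- The blow-up monad map `A_m̃(x₁,x₂,x₃,y₁,y₂) : W₁ ⊕ W₀ → W₀ ⊕ W₁ ⊕ W₀ ⊕ W₁ ⊕ ℂʳ`. -/
noncomputable def blowupA {W₀ W₁ : Type*} [AddCommGroup W₀] [Module ℂ W₀]
    [AddCommGroup W₁] [Module ℂ W₁] {r : ℕ}
    (a₁ a₂ : W₁ →ₗ[ℂ] W₀) (d : W₀ →ₗ[ℂ] W₁) (c : W₁ →ₗ[ℂ] (Fin r → ℂ))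
    (x₁ x₂ x₃ y₁ y₂ : ℂ) :
    (W₁ × W₀) →ₗ[ℂ] (W₀ × W₁ × W₀ × W₁ × (Fin r → ℂ)) :=
  LinearMap.prod
    ((x₃ • a₁).comp (LinearMap.fst ℂ W₁ W₀)
      - (y₂ • LinearMap.id).comp (LinearMap.snd ℂ W₁ W₀))
    (LinearMap.prod
      ((x₁ • LinearMap.id - x₃ • (d ∘ₗ a₁)).comp (LinearMap.fst ℂ W₁ W₀))
      (LinearMap.prod
        ((x₃ • a₂).comp (LinearMap.fst ℂ W₁ W₀)
          + (y₁ • LinearMap.id).comp (LinearMap.snd ℂ W₁ W₀))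
        (LinearMap.prod
          ((x₂ • LinearMap.id - x₃ • (d ∘ₗ a₂)).comp (LinearMap.fst ℂ W₁ W₀))
          ((x₃ • c).comp (LinearMap.fst ℂ W₁ W₀)))))

section Projections

variable {W₀ W₁ : Type*} [AddCommGroup W₀] [Module ℂ W₀]
  [AddCommGroup W₁] [Module ℂ W₁] {r : ℕ}

/-- Projection onto the first `W₀` factor. -/
noncomputable def proj1 : (W₀ × W₁ × W₀ × W₁ × (Fin r → ℂ)) →ₗ[ℂ] W₀ :=
  LinearMap.fst ℂ W₀ (W₁ × W₀ × W₁ × (Fin r → ℂ))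

/-- Projection onto the first `W₁` factor. -/
noncomputable def proj2 : (W₀ × W₁ × W₀ × W₁ × (Fin r → ℂ)) →ₗ[ℂ] W₁ :=
  (LinearMap.fst ℂ W₁ (W₀ × W₁ × (Fin r → ℂ))).comp
    (LinearMap.snd ℂ W₀ (W₁ × W₀ × W₁ × (Fin r → ℂ)))

/-- Projection onto the second `W₀` factor. -/
noncomputable def proj3 : (W₀ × W₁ × W₀ × W₁ × (Fin r → ℂ)) →ₗ[ℂ] W₀ :=
  (LinearMap.fst ℂ W₀ (W₁ × (Fin r → ℂ))).comp
    ((LinearMap.snd ℂ W₁ (W₀ × W₁ × (Fin r → ℂ))).comp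
      (LinearMap.snd ℂ W₀ (W₁ × W₀ × W₁ × (Fin r → ℂ))))

/-- Projection onto the second `W₁` factor. -/
noncomputable def proj4 : (W₀ × W₁ × W₀ × W₁ × (Fin r → ℂ)) →ₗ[ℂ] W₁ :=
  (LinearMap.fst ℂ W₁ (Fin r → ℂ)).comp
    ((LinearMap.snd ℂ W₀ (W₁ × (Fin r → ℂ))).comp
      ((LinearMap.snd ℂ W₁ (W₀ × W₁ × (Fin r → ℂ))).comp
        (LinearMap.snd ℂ W₀ (W₁ × W₀ × W₁ × (Fin r → ℂ)))))

/-- Projection onto the `ℂʳ` factor. -/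
noncomputable def proj5 : (W₀ × W₁ × W₀ × W₁ × (Fin r → ℂ)) →ₗ[ℂ] (Fin r → ℂ) :=
  (LinearMap.snd ℂ W₁ (Fin r → ℂ)).comp
    ((LinearMap.snd ℂ W₀ (W₁ × (Fin r → ℂ))).comp
      ((LinearMap.snd ℂ W₁ (W₀ × W₁ × (Fin r → ℂ))).comp
        (LinearMap.snd ℂ W₀ (W₁ × W₀ × W₁ × (Fin r → ℂ)))))

/-- The projection `p : W₀ ⊕ W₁ ⊕ W₀ ⊕ W₁ ⊕ ℂʳ → W₁ ⊕ W₁ ⊕ ℂʳ`,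
`(v₀¹, v₁¹, v₀², v₁², u) ↦ (v₁¹, v₁², u)`. -/
noncomputable def blowupProj : (W₀ × W₁ × W₀ × W₁ × (Fin r → ℂ)) →ₗ[ℂ] (W₁ × W₁ × (Fin r → ℂ)) :=
  LinearMap.prod (proj2) (LinearMap.prod (proj4) (proj5))

end Projections

/-- The blow-up monad map `B_m̃(x₁,x₂,x₃,y₁,y₂) : W₀ ⊕ W₁ ⊕ W₀ ⊕ W₁ ⊕ ℂʳ → W₀ ⊕ W₁`. -/
noncomputable def blowupB {W₀ W₁ : Type*} [AddCommGroup W₀] [Module ℂ W₀]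
    [AddCommGroup W₁] [Module ℂ W₁] {r : ℕ}
    (a₁ a₂ : W₁ →ₗ[ℂ] W₀) (d : W₀ →ₗ[ℂ] W₁) (b : (Fin r → ℂ) →ₗ[ℂ] W₀)
    (x₁ x₂ x₃ y₁ y₂ : ℂ) :
    (W₀ × W₁ × W₀ × W₁ × (Fin r → ℂ)) →ₗ[ℂ] (W₀ × W₁) :=
  LinearMap.prod
    (x₂ • proj1 + (x₃ • a₂).comp proj2 - x₁ • proj3 - (x₃ • a₁).comp proj4
      + (x₃ • b).comp proj5)
    ((y₁ • d).comp proj1 + y₁ • proj2 + (y₂ • d).comp proj3 + y₂ • proj4)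

/-- A linear map of two-term subquotients `K / R → K' / R'` that is injective and surjective modulo
`R` and `R'` induces a linear equivalence. -/
theorem exists_subquotient_linearEquiv {k M N : Type*} [Ring k] [AddCommGroup M] [Module k M]
    [AddCommGroup N] [Module k N] (f : M →ₗ[k] N) (K R : Submodule k M) (K' R' : Submodule k N)
    (hK : ∀ q ∈ K, f q ∈ K') (hR : ∀ q ∈ K, q ∈ R ↔ f q ∈ R')
    (hsurj : ∀ y ∈ K', ∃ q ∈ K, f q = y) :
    ∃ e : (↥K ⧸ R.comap K.subtype) ≃ₗ[k] (↥K' ⧸ R'.comap K'.subtype),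
      ∀ (q : K) (hq : f q.1 ∈ K'),
        e (Submodule.Quotient.mk q) = Submodule.Quotient.mk (⟨f q.1, hq⟩ : K') := by
  have hcomap : R.comap K.subtype ≤ (R'.comap K'.subtype).comap (f.restrict hK) := by
    intro q hq
    exact (hR q.1 q.2).1 hq
  refine ⟨LinearEquiv.ofBijective (Submodule.mapQ _ _ (f.restrict hK) hcomap) ⟨?_, ?_⟩,
    fun q hq => rfl⟩
  · rw [injective_iff_map_eq_zero]
    intro z hz
    obtain ⟨q, rfl⟩ := Submodule.Quotient.mk_surjective _ z
    rw [Submodule.mapQ_apply, Submodule.Quotient.mk_eq_zero] at hz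
    rw [Submodule.Quotient.mk_eq_zero]
    exact (hR q.1 q.2).2 hz
  · intro z
    obtain ⟨y, rfl⟩ := Submodule.Quotient.mk_surjective _ z
    obtain ⟨q, hq, hqy⟩ := hsurj y.1 y.2
    refine ⟨Submodule.Quotient.mk ⟨q, hq⟩, ?_⟩
    rw [Submodule.mapQ_apply]
    exact congrArg _ (Subtype.ext hqy)

/-- Exactness of the Koszul complex of a nonzero pair of scalars in the middle degree. -/
theorem exists_smul_eq_of_smul_eq {k V : Type*} [Field k] [AddCommGroup V] [Module k V]
    {x₁ x₂ : k} (hx : (x₁, x₂) ≠ (0, 0)) {v w : V} (h : x₂ • v = x₁ • w) :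
    ∃ t : V, x₁ • t = v ∧ x₂ • t = w := by
  by_cases h₁ : x₁ = 0
  · have h₂ : x₂ ≠ 0 := fun h₂ => hx (by rw [h₁, h₂])
    refine ⟨x₂⁻¹ • w, ?_, smul_inv_smul₀ h₂ w⟩
    rw [smul_comm, ← h, inv_smul_smul₀ h₂]
  · refine ⟨x₁⁻¹ • v, smul_inv_smul₀ h₁ v, ?_⟩
    rw [smul_comm, h, inv_smul_smul₀ h₁]

/-- Exactness of the Koszul complex of a nonzero pair of scalars in the last degree. -/
theorem exists_smul_sub_smul_eq {k V : Type*} [Field k] [AddCommGroup V] [Module k V]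
    {x₁ x₂ : k} (hx : (x₁, x₂) ≠ (0, 0)) (y : V) :
    ∃ v w : V, x₂ • v - x₁ • w = y := by
  by_cases h₁ : x₁ = 0
  · have h₂ : x₂ ≠ 0 := fun h₂ => hx (by rw [h₁, h₂])
    exact ⟨x₂⁻¹ • y, 0, by rw [smul_inv_smul₀ h₂, smul_zero, sub_zero]⟩
  · exact ⟨0, -(x₁⁻¹ • y), by rw [smul_neg, smul_inv_smul₀ h₁, smul_zero, zero_sub, neg_neg]⟩

section BlowupMonad

variable {W₀ W₁ : Type*} [AddCommGroup W₀] [Module ℂ W₀] [AddCommGroup W₁] [Module ℂ W₁] {r : ℕ}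

theorem blowupA_apply (a₁ a₂ : W₁ →ₗ[ℂ] W₀) (d : W₀ →ₗ[ℂ] W₁) (c : W₁ →ₗ[ℂ] (Fin r → ℂ))
    (x₁ x₂ x₃ y₁ y₂ : ℂ) (ξ : W₁) (η : W₀) :
    blowupA a₁ a₂ d c x₁ x₂ x₃ y₁ y₂ (ξ, η)
      = (x₃ • a₁ ξ - y₂ • η, x₁ • ξ - x₃ • d (a₁ ξ), x₃ • a₂ ξ + y₁ • η,
          x₂ • ξ - x₃ • d (a₂ ξ), x₃ • c ξ) :=
  rfl

theorem blowupB_apply (a₁ a₂ : W₁ →ₗ[ℂ] W₀) (d : W₀ →ₗ[ℂ] W₁) (b : (Fin r → ℂ) →ₗ[ℂ] W₀)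
    (x₁ x₂ x₃ y₁ y₂ : ℂ) (v : W₀) (v' : W₁) (w : W₀) (w' : W₁) (u : Fin r → ℂ) :
    blowupB a₁ a₂ d b x₁ x₂ x₃ y₁ y₂ (v, v', w, w', u)
      = (x₂ • v + x₃ • a₂ v' - x₁ • w - x₃ • a₁ w' + x₃ • b u,
          y₁ • d v + y₁ • v' + y₂ • d w + y₂ • w') :=
  rfl

theorem adhmB_apply (a₁ a₂ : W₁ →ₗ[ℂ] W₁) (b : (Fin r → ℂ) →ₗ[ℂ] W₁) (x₁ x₂ x₃ : ℂ)
    (v w : W₁) (u : Fin r → ℂ) :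
    adhmB a₁ a₂ b x₁ x₂ x₃ (v, w, u)
      = x₃ • a₂ v - x₂ • v + (x₁ • w - x₃ • a₁ w) + x₃ • b u :=
  rfl

theorem blowupProj_apply (v : W₀) (v' : W₁) (w : W₀) (w' : W₁) (u : Fin r → ℂ) :
    blowupProj (v, v', w, w', u) = (v', w', u) :=
  rfl

theorem blowupProj_blowupA (a₁ a₂ : W₁ →ₗ[ℂ] W₀) (d : W₀ →ₗ[ℂ] W₁) (c : W₁ →ₗ[ℂ] (Fin r → ℂ))
    (x₁ x₂ x₃ y₁ y₂ : ℂ) (p : W₁ × W₀) :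
    blowupProj (blowupA a₁ a₂ d c x₁ x₂ x₃ y₁ y₂ p) = adhmA (d ∘ₗ a₁) (d ∘ₗ a₂) c x₁ x₂ x₃ p.1 :=
  rfl

theorem adhmB_blowupProj (a₁ a₂ : W₁ →ₗ[ℂ] W₀) (d : W₀ →ₗ[ℂ] W₁) (b : (Fin r → ℂ) →ₗ[ℂ] W₀)
    (x₁ x₂ x₃ : ℂ) (q : W₀ × W₁ × W₀ × W₁ × (Fin r → ℂ)) :
    adhmB (d ∘ₗ a₁) (d ∘ₗ a₂) (d ∘ₗ b) x₁ x₂ x₃ (blowupProj q)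
      = d (blowupB a₁ a₂ d b x₁ x₂ x₃ x₂ (-x₁) q).1
        - (blowupB a₁ a₂ d b x₁ x₂ x₃ x₂ (-x₁) q).2 := by
  obtain ⟨v, v', w, w', u⟩ := q
  simp only [blowupProj_apply, adhmB_apply, blowupB_apply, LinearMap.comp_apply, map_add, map_sub,
    map_smul]
  module

theorem blowupB_blowupA (a₁ a₂ : W₁ →ₗ[ℂ] W₀) (d : W₀ →ₗ[ℂ] W₁)
    (b : (Fin r → ℂ) →ₗ[ℂ] W₀) (c : W₁ →ₗ[ℂ] (Fin r → ℂ))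
    (hint : a₁ ∘ₗ d ∘ₗ a₂ - a₂ ∘ₗ d ∘ₗ a₁ + b ∘ₗ c = 0) (x₁ x₂ x₃ : ℂ) (p : W₁ × W₀) :
    blowupB a₁ a₂ d b x₁ x₂ x₃ x₂ (-x₁) (blowupA a₁ a₂ d c x₁ x₂ x₃ x₂ (-x₁) p) = 0 := by
  obtain ⟨ξ, η⟩ := p
  have h : a₁ (d (a₂ ξ)) - a₂ (d (a₁ ξ)) + b (c ξ) = 0 := LinearMap.congr_fun hint ξ
  rw [blowupA_apply, blowupB_apply]
  simp only [map_add, map_sub, map_smul]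
  refine Prod.ext ?_ ?_
  · simp only [Prod.fst_zero]
    linear_combination (norm := module) (x₃ ^ 2) • h
  · simp only [Prod.snd_zero]
    module

theorem mem_range_blowupA_of_blowupProj_eq_zero (a₁ a₂ : W₁ →ₗ[ℂ] W₀) (d : W₀ →ₗ[ℂ] W₁)
    (b : (Fin r → ℂ) →ₗ[ℂ] W₀) (c : W₁ →ₗ[ℂ] (Fin r → ℂ)) {x₁ x₂ : ℂ} (x₃ : ℂ)
    (hx : (x₁, x₂) ≠ (0, 0)) {q : W₀ × W₁ × W₀ × W₁ × (Fin r → ℂ)}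
    (hq : blowupB a₁ a₂ d b x₁ x₂ x₃ x₂ (-x₁) q = 0) (hPq : blowupProj q = 0) :
    q ∈ LinearMap.range (blowupA a₁ a₂ d c x₁ x₂ x₃ x₂ (-x₁)) := by
  obtain ⟨v, v', w, w', u⟩ := q
  simp only [blowupProj_apply, Prod.mk_eq_zero] at hPq
  obtain ⟨rfl, rfl, rfl⟩ := hPq
  rw [blowupB_apply] at hq
  have hvw : x₂ • v = x₁ • w := by
    simpa [sub_eq_zero] using congrArg Prod.fst hq
  obtain ⟨t, rfl, rfl⟩ := exists_smul_eq_of_smul_eq hx hvw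
  exact ⟨(0, t), by simp [blowupA_apply]⟩

theorem exists_blowupB_eq_zero_of_adhmB_eq_zero (a₁ a₂ : W₁ →ₗ[ℂ] W₀) (d : W₀ →ₗ[ℂ] W₁)
    (b : (Fin r → ℂ) →ₗ[ℂ] W₀) {x₁ x₂ : ℂ} (x₃ : ℂ)
    (hx : (x₁, x₂) ≠ (0, 0)) {y : W₁ × W₁ × (Fin r → ℂ)}
    (hy : adhmB (d ∘ₗ a₁) (d ∘ₗ a₂) (d ∘ₗ b) x₁ x₂ x₃ y = 0) :
    ∃ q : W₀ × W₁ × W₀ × W₁ × (Fin r → ℂ),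
      blowupB a₁ a₂ d b x₁ x₂ x₃ x₂ (-x₁) q = 0 ∧ blowupProj q = y := by
  obtain ⟨v', w', u⟩ := y
  obtain ⟨v, w, hvw⟩ := exists_smul_sub_smul_eq hx (-(x₃ • a₂ v' - x₃ • a₁ w' + x₃ • b u))
  have hfst : (blowupB a₁ a₂ d b x₁ x₂ x₃ x₂ (-x₁) (v, v', w, w', u)).1 = 0 := by
    rw [blowupB_apply]
    linear_combination (norm := module) hvw
  have hsnd := adhmB_blowupProj a₁ a₂ d b x₁ x₂ x₃ (v, v', w, w', u)
  rw [blowupProj_apply, hy, hfst, map_zero, zero_sub, eq_comm, neg_eq_zero] at hsnd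
  exact ⟨_, Prod.ext hfst hsnd, blowupProj_apply ..⟩

end BlowupMonad

/-- For a blow-up monad configuration `m̃ = (a₁,a₂,d,b,c)` with associated
ADHM configuration `m = π_#(m̃) = (d∘a₁, d∘a₂, d∘b, c)` on `W = W₁`, fixing
`(x₁,x₂,x₃)` with `(x₁,x₂) ≠ (0,0)` and setting `y₁ = x₂`, `y₂ = −x₁`: the projection
`p` maps `ker B_m̃` into `ker B_m`, satisfies `p ∘ A_m̃(ξ₁,ξ₀) = A_m(ξ₁)`, and the
induced linear map on monad cohomologies `ker B_m̃ / range A_m̃ → ker B_m / range A_m`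
is an isomorphism. -/
theorem blowup_monad_pushforward_iso
    {W₀ W₁ : Type*} [AddCommGroup W₀] [Module ℂ W₀] [AddCommGroup W₁] [Module ℂ W₁]
    [FiniteDimensional ℂ W₀] [FiniteDimensional ℂ W₁]
    {r : ℕ} (hr : 1 ≤ r)
    (a₁ a₂ : W₁ →ₗ[ℂ] W₀) (d : W₀ →ₗ[ℂ] W₁)
    (b : (Fin r → ℂ) →ₗ[ℂ] W₀) (c : W₁ →ₗ[ℂ] (Fin r → ℂ))
    (hint : a₁ ∘ₗ d ∘ₗ a₂ - a₂ ∘ₗ d ∘ₗ a₁ + b ∘ₗ c = 0)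
    (x₁ x₂ x₃ : ℂ) (hx : (x₁, x₂) ≠ (0, 0))
    (AT : (W₁ × W₀) →ₗ[ℂ] (W₀ × W₁ × W₀ × W₁ × (Fin r → ℂ)))
    (hAT : AT = blowupA a₁ a₂ d c x₁ x₂ x₃ x₂ (-x₁))
    (BT : (W₀ × W₁ × W₀ × W₁ × (Fin r → ℂ)) →ₗ[ℂ] (W₀ × W₁))
    (hBT : BT = blowupB a₁ a₂ d b x₁ x₂ x₃ x₂ (-x₁))
    (AM : W₁ →ₗ[ℂ] (W₁ × W₁ × (Fin r → ℂ)))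
    (hAM : AM = adhmA (d ∘ₗ a₁) (d ∘ₗ a₂) c x₁ x₂ x₃)
    (BM : (W₁ × W₁ × (Fin r → ℂ)) →ₗ[ℂ] W₁)
    (hBM : BM = adhmB (d ∘ₗ a₁) (d ∘ₗ a₂) (d ∘ₗ b) x₁ x₂ x₃)
    (P : (W₀ × W₁ × W₀ × W₁ × (Fin r → ℂ)) →ₗ[ℂ] (W₁ × W₁ × (Fin r → ℂ)))
    (hP : P = blowupProj) :
    (∀ q, BT q = 0 → BM (P q) = 0)
    ∧ (∀ p : W₁ × W₀, P (AT p) = AM p.1)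
    ∧ ∃ e : (↥(LinearMap.ker BT) ⧸ (LinearMap.range AT).comap (LinearMap.ker BT).subtype)
          ≃ₗ[ℂ]
        (↥(LinearMap.ker BM) ⧸ (LinearMap.range AM).comap (LinearMap.ker BM).subtype),
      ∀ (q : LinearMap.ker BT) (hq : P q.1 ∈ LinearMap.ker BM),
        e (Submodule.Quotient.mk q)
          = Submodule.Quotient.mk (⟨P q.1, hq⟩ : LinearMap.ker BM) := by
  subst hAT hBT hAM hBM hP
  have hK : ∀ q, blowupB a₁ a₂ d b x₁ x₂ x₃ x₂ (-x₁) q = 0 →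
      adhmB (d ∘ₗ a₁) (d ∘ₗ a₂) (d ∘ₗ b) x₁ x₂ x₃ (blowupProj q) = 0 := by
    intro q hq
    rw [adhmB_blowupProj, hq, Prod.fst_zero, Prod.snd_zero, map_zero, sub_zero]
  refine ⟨hK, blowupProj_blowupA a₁ a₂ d c x₁ x₂ x₃ x₂ (-x₁),
    exists_subquotient_linearEquiv _ _ _ _ _ hK (fun q hq => ⟨?_, ?_⟩)
      fun y hy => exists_blowupB_eq_zero_of_adhmB_eq_zero a₁ a₂ d b x₃ hx hy⟩
  · rintro ⟨p, rfl⟩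
    exact ⟨p.1, (blowupProj_blowupA ..).symm⟩
  · rintro ⟨ξ, hξ⟩
    rw [← sub_add_cancel q (blowupA a₁ a₂ d c x₁ x₂ x₃ x₂ (-x₁) (ξ, 0))]
    refine add_mem (mem_range_blowupA_of_blowupProj_eq_zero a₁ a₂ d b c x₃ hx ?_ ?_) ⟨_, rfl⟩
    · rw [map_sub, blowupB_blowupA a₁ a₂ d b c hint, sub_zero]
      exact hq
    · rw [map_sub, blowupProj_blowupA, hξ, sub_self]
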